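/- Let H be an ordered graph on h vertices and let B be a complete k-partite unordered graph with k ≥ 2 nonempty parts that is a bottlegraph assigned to H. Then for every η>0 there exists n₀∈ℕ such that every ordered graph G on n ≥ n₀ vertices with minimum degree δ(G) ≥ (1 − 1/χ_cr(B) + η)n contains an H-tiling covering all but at most ηn vertices of G. -/

import Mathlib

open Finset

section Defs

variable {h n : ℕ}

/-- `φ` is an order-preserving embedding of the ordered graph `H` into the ordered graph `G`:
a strictly increasing map carrying edges of `H` to edges of `G`. -/
def IsOrderedCopy (H : SimpleGraph (Fin h)) (G : SimpleGraph (Fin n))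
    (φ : Fin h → Fin n) : Prop :=
  StrictMono φ ∧ ∀ i j : Fin h, H.Adj i j → G.Adj (φ i) (φ j)

/-- `S` is the vertex set of a copy of the ordered graph `H` in the ordered graph `G`. -/
def IsCopySet (H : SimpleGraph (Fin h)) (G : SimpleGraph (Fin n))
    (S : Finset (Fin n)) : Prop :=
  ∃ φ : Fin h → Fin n, IsOrderedCopy H G φ ∧ Finset.image φ Finset.univ = S

/-- `G` has an `H`-tiling (vertex-disjoint copies of `H`) whose copies exactly cover the
vertex set `S`; equivalently, the induced ordered subgraph `G[S]` has a perfect `H`-tiling. -/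
def HasPerfectTilingOn (H : SimpleGraph (Fin h)) (G : SimpleGraph (Fin n))
    (S : Finset (Fin n)) : Prop :=
  ∃ 𝒯 : Finset (Finset (Fin n)),
    (∀ T ∈ 𝒯, IsCopySet H G T) ∧
    (𝒯 : Set (Finset (Fin n))).PairwiseDisjoint id ∧
    𝒯.biUnion id = S

/-- `G` has a perfect `H`-tiling. -/
def HasPerfectTiling (H : SimpleGraph (Fin h)) (G : SimpleGraph (Fin n)) : Prop :=
  HasPerfectTilingOn H G Finset.univ

/-- The degree of a vertex in an ordered graph. -/
noncomputable def odeg (G : SimpleGraph (Fin n)) (v : Fin n) : ℕ :=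
  (G.neighborSet v).ncard

/-- `[h]` can be partitioned into `k` intervals, each independent in `H`
(expressed via a monotone colouring with independent fibres). -/
def HasIntervalColoring (H : SimpleGraph (Fin h)) (k : ℕ) : Prop :=
  ∃ c : Fin h → Fin k, Monotone c ∧ ∀ i j : Fin h, H.Adj i j → c i ≠ c j

/-- The interval chromatic number `χ<(H)` of an ordered graph. -/
noncomputable def intervalChi (H : SimpleGraph (Fin h)) : ℕ :=
  sInf {k | HasIntervalColoring H k}

/-- `α⁺ᵢ(H)`: `α⁺₀ = 0`, and `α⁺_{i+1}` is the largest `k ≤ h` such that the interval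
`[α⁺ᵢ + 1, k]` is independent in `H` (vertices are 1-indexed via `v ↦ (v : ℕ) + 1`). -/
noncomputable def alphaPlus (H : SimpleGraph (Fin h)) : ℕ → ℕ
  | 0 => 0
  | (i + 1) => sSup {k | k ≤ h ∧ ∀ a b : Fin h,
      alphaPlus H i + 1 ≤ (a : ℕ) + 1 → (a : ℕ) + 1 ≤ k →
      alphaPlus H i + 1 ≤ (b : ℕ) + 1 → (b : ℕ) + 1 ≤ k → ¬ H.Adj a b}

/-- `α⁻ᵢ(H)`: `α⁻₀ = h + 1`, and `α⁻_{i+1}` is the smallest `k ≥ 1` such that the interval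
`[k, α⁻ᵢ − 1]` is independent in `H`. -/
noncomputable def alphaMinus (H : SimpleGraph (Fin h)) : ℕ → ℕ
  | 0 => h + 1
  | (i + 1) => sInf {k | 1 ≤ k ∧ ∀ a b : Fin h,
      k ≤ (a : ℕ) + 1 → (a : ℕ) + 1 ≤ alphaMinus H i - 1 →
      k ≤ (b : ℕ) + 1 → (b : ℕ) + 1 ≤ alphaMinus H i - 1 → ¬ H.Adj a b}

/-- `α*(H) = min over 1 ≤ ℓ < χ<(H) of min{α⁺_ℓ/(ℓh), (h − α⁻_ℓ + 1)/(ℓh)}`. -/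
noncomputable def alphaStar (H : SimpleGraph (Fin h)) : ℝ :=
  sInf {x : ℝ | ∃ ℓ : ℕ, 1 ≤ ℓ ∧ ℓ < intervalChi H ∧
    (x = (alphaPlus H ℓ : ℝ) / (ℓ * h) ∨
     x = ((h : ℝ) - alphaMinus H ℓ + 1) / (ℓ * h))}

/-- `α*(H)` for ordered graphs with interval chromatic number 2:
`min{α⁺₁(H)/h, (h − α⁻₁(H) + 1)/h}`. -/
noncomputable def alphaStar2 (H : SimpleGraph (Fin h)) : ℝ :=
  min ((alphaPlus H 1 : ℝ) / h) (((h : ℝ) - alphaMinus H 1 + 1) / h)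

/-- Property A: no edges of `H` within `[1, ⌊h/2⌋ + 1]` nor within `[⌈h/2⌉, h]`. -/
def PropertyA (H : SimpleGraph (Fin h)) : Prop :=
  (∀ a b : Fin h, (a : ℕ) + 1 ≤ h / 2 + 1 → (b : ℕ) + 1 ≤ h / 2 + 1 → ¬ H.Adj a b) ∧
  (∀ a b : Fin h, (h + 1) / 2 ≤ (a : ℕ) + 1 → (h + 1) / 2 ≤ (b : ℕ) + 1 → ¬ H.Adj a b)

/-- Property B: for each partition of `[h]` into nonempty intervals `[1, i], [i+1, h]`
there is an edge of `H` between them. -/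
def PropertyB (H : SimpleGraph (Fin h)) : Prop :=
  ∀ i : ℕ, 1 ≤ i → i < h →
    ∃ a b : Fin h, H.Adj a b ∧ (a : ℕ) + 1 ≤ i ∧ i + 1 ≤ (b : ℕ) + 1

/-- `s(H)`: the smallest vertex adjacent to `h`, and `0` if `h` is isolated. -/
noncomputable def sOG (H : SimpleGraph (Fin h)) : ℕ :=
  sInf {k | ∃ a b : Fin h, H.Adj a b ∧ (a : ℕ) + 1 = k ∧ (b : ℕ) + 1 = h}

open Classical in
/-- `l(H)`: the largest vertex adjacent to `1`, and `h + 1` if `1` is isolated. -/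
noncomputable def lOG (H : SimpleGraph (Fin h)) : ℕ :=
  if ∃ a b : Fin h, H.Adj a b ∧ (a : ℕ) + 1 = 1 then
    sSup {k | ∃ a b : Fin h, H.Adj a b ∧ (a : ℕ) + 1 = 1 ∧ (b : ℕ) + 1 = k}
  else h + 1

/-- The vertex `h` has Property C: `s(H) ≥ 1` and there is an edge within `[s(H), h − 1]`. -/
def PropertyCLast (H : SimpleGraph (Fin h)) : Prop :=
  1 ≤ sOG H ∧ ∃ a b : Fin h, H.Adj a b ∧
    sOG H ≤ (a : ℕ) + 1 ∧ (a : ℕ) + 1 ≤ h - 1 ∧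
    sOG H ≤ (b : ℕ) + 1 ∧ (b : ℕ) + 1 ≤ h - 1

/-- The vertex `1` has Property C: `l(H) ≤ h` and there is an edge within `[2, l(H)]`. -/
def PropertyCFirst (H : SimpleGraph (Fin h)) : Prop :=
  lOG H ≤ h ∧ ∃ a b : Fin h, H.Adj a b ∧
    2 ≤ (a : ℕ) + 1 ∧ (a : ℕ) + 1 ≤ lOG H ∧
    2 ≤ (b : ℕ) + 1 ∧ (b : ℕ) + 1 ≤ lOG H

/-- `S` is an `H`-absorbing set for `W`: both `G[S]` and `G[S ∪ W]` have perfect `H`-tilings. -/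
def IsAbsorbingFor (H : SimpleGraph (Fin h)) (G : SimpleGraph (Fin n))
    (S W : Finset (Fin n)) : Prop :=
  HasPerfectTilingOn H G S ∧ HasPerfectTilingOn H G (S ∪ W)

end Defs

section Regularity

/-- The density `d(A,B) = e(A,B)/(|A||B|)` of a pair of vertex sets in a graph. -/
noncomputable def pairDensity {V : Type*} (G : SimpleGraph V) (A B : Finset V) : ℝ :=
  ({e : V × V | e.1 ∈ A ∧ e.2 ∈ B ∧ G.Adj e.1 e.2}.ncard : ℝ) /
    ((A.card : ℝ) * (B.card : ℝ))

/-- The pair `(A, B)` is `ε`-regular in `G`. -/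
def IsRegularPair {V : Type*} (G : SimpleGraph V) (A B : Finset V) (ε : ℝ) : Prop :=
  ∀ X ⊆ A, ∀ Y ⊆ B, ε * A.card ≤ (X.card : ℝ) → ε * B.card ≤ (Y.card : ℝ) →
    |pairDensity G A B - pairDensity G X Y| < ε

end Regularity

section Bottle

/-- The chromatic number of a finite graph. -/
noncomputable def chromNum {m : ℕ} (B : SimpleGraph (Fin m)) : ℕ :=
  sInf {k | ∃ c : Fin m → Fin k, ∀ x y : Fin m, B.Adj x y → c x ≠ c y}

/-- `σ(B)`: the smallest size of a colour class in any proper colouring of `B`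
with `χ(B)` colours. -/
noncomputable def sigmaMinCl {m : ℕ} (B : SimpleGraph (Fin m)) : ℕ :=
  sInf {c | ∃ C : Fin m → Fin (chromNum B),
    (∀ x y : Fin m, B.Adj x y → C x ≠ C y) ∧
    ∃ i : Fin (chromNum B), c = (Finset.univ.filter (fun v => C v = i)).card}

/-- The critical chromatic number `χ_cr(B) = (χ(B) − 1)·|B|/(|B| − σ(B))`. -/
noncomputable def critChrom {m : ℕ} (B : SimpleGraph (Fin m)) : ℝ :=
  ((chromNum B : ℝ) - 1) * m / ((m : ℝ) - sigmaMinCl B)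

/-- `φ` is an interval labeling of the complete multipartite graph with part function `p`
(with respect to some permutation `σ` of the parts). -/
def IsIntervalLabeling {m k : ℕ} (p : Fin m → Fin k) (φ : Equiv.Perm (Fin m)) : Prop :=
  ∃ σ : Equiv.Perm (Fin k), ∀ x y : Fin m, σ (p x) < σ (p y) → φ x < φ y

/-- `G` is (an isomorphic realisation of) the ordered blow-up `(B(t), φ)` of the complete
multipartite graph `B` with part function `p`: there is a block assignment `β` whose fibres
all have size `t`, compatible with the order induced by `φ`, with adjacency between blocks
given by `B`. -/
def IsOrderedBlowup {m k : ℕ} (p : Fin m → Fin k) (φ : Equiv.Perm (Fin m)) (t : ℕ)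
    {N : ℕ} (G : SimpleGraph (Fin N)) : Prop :=
  ∃ β : Fin N → Fin m,
    (∀ x : Fin m, {u : Fin N | β u = x}.ncard = t) ∧
    (∀ u v : Fin N, u ≤ v → φ (β u) ≤ φ (β v)) ∧
    (∀ u v : Fin N, G.Adj u v ↔ p (β u) ≠ p (β v))

/-- The complete multipartite graph with part function `p` is a bottlegraph assigned to `H`:
for every interval labeling `φ` there is a `t ≥ 1` such that the ordered blow-up `(B(t), φ)`
has a perfect `H`-tiling. -/
def IsBottlegraph {h m k : ℕ} (H : SimpleGraph (Fin h)) (p : Fin m → Fin k) : Prop :=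
  ∀ φ : Equiv.Perm (Fin m), IsIntervalLabeling p φ →
    ∃ t : ℕ, 0 < t ∧ ∀ (N : ℕ) (G : SimpleGraph (Fin N)),
      IsOrderedBlowup p φ t G → HasPerfectTiling H G

end Bottle

/-- Greedy choice of a clique: each new vertex minimises `y` over the common neighbourhood of its
predecessors. -/
lemma exists_greedy_clique {V : Type*} [Finite V] [Nonempty V] (y : V → ℝ)
    (R : V → V → Prop) (r : ℕ)
    (hR : ∀ (v : ℕ → V) (j : ℕ), j ≤ r → ∃ w, ∀ i < j, R (v i) w) :
    ∃ v : ℕ → V, (∀ i j, i < j → j ≤ r → R (v i) (v j)) ∧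
      ∀ j ≤ r, ∀ w, (∀ i < j, R (v i) w) → y (v j) ≤ y w := by
  suffices h : ∀ s ≤ r + 1, ∃ v : ℕ → V, (∀ i j, i < j → j < s → R (v i) (v j)) ∧
      ∀ j < s, ∀ w, (∀ i < j, R (v i) w) → y (v j) ≤ y w by
    obtain ⟨v, h1, h2⟩ := h (r + 1) le_rfl
    exact ⟨v, fun i j hij hj => h1 i j hij (by omega), fun j hj => h2 j (by omega)⟩
  intro s
  induction s with
  | zero =>
    intro _
    exact ⟨fun _ => Classical.arbitrary V, by simp, by simp⟩
  | succ s ih =>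
    intro hs
    obtain ⟨v, h1, h2⟩ := ih (by omega)
    obtain ⟨w, hw, hmin⟩ := Set.exists_min_image {w | ∀ i < s, R (v i) w} y (Set.toFinite _)
      (hR v s (by omega))
    refine ⟨Function.update v s w, ?_, ?_⟩
    · intro i j hij hj
      rw [Function.update_of_ne (by omega : i ≠ s)]
      rcases Nat.lt_succ_iff_lt_or_eq.1 hj with hj | rfl
      · rw [Function.update_of_ne (by omega : j ≠ s)]
        exact h1 i j hij hj
      · rw [Function.update_self]
        exact hw i hij
    · intro j hj x hx
      have hx' : ∀ i < j, R (v i) x := fun i hi => by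
        have := hx i hi
        rwa [Function.update_of_ne (by omega : i ≠ s)] at this
      rcases Nat.lt_succ_iff_lt_or_eq.1 hj with hj | rfl
      · rw [Function.update_of_ne (by omega : j ≠ s)]
        exact h2 j hj x hx'
      · rw [Function.update_self]
        exact hmin x hx'

lemma sum_mul_sum_fin_add {r : ℕ} (a b : Fin (r + 1) → ℝ) :
    ∑ s, ∑ j, a j * b (j + s) = (∑ j, a j) * ∑ j, b j := by
  rw [Finset.sum_comm, Finset.sum_mul]
  refine Finset.sum_congr rfl fun j _ => ?_
  rw [← Finset.mul_sum]
  congr 1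
  exact Equiv.sum_comp (Equiv.addLeft j) b

/-- A weak-duality bound: a weighting `y` in which every ordered clique on `r + 2` vertices has
`u`-weight at least `M` has large total, provided that every neighbourhood is large. -/
lemma le_sum_mul_of_forall_clique {V : Type*} [Fintype V] [Nonempty V] (R : V → V → Prop)
    [DecidableRel R] (hsymm : ∀ a b, R a b → R b a) (μ : V → ℝ) (hμ : ∀ a, 0 ≤ μ a)
    (hW : 0 < ∑ a, μ a) {r : ℕ} (u : Fin (r + 2) → ℝ) (i₀ : Fin (r + 2)) (hu₀ : 0 < u i₀)
    (hu : ∀ i, 0 ≤ u i)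
    (hdeg : ∀ a, ((r + 1 : ℝ) * ∑ i, u i) * (∑ b with ¬ R a b, μ b) ≤
      ((∑ i, u i) - u i₀) * ∑ b, μ b)
    (y : V → ℝ) (M : ℝ)
    (hy : ∀ c : Fin (r + 2) → V, (∀ i j, i ≠ j → R (c i) (c j)) → M ≤ ∑ i, u i * y (c i)) :
    M * ∑ a, μ a ≤ (∑ i, u i) * ∑ a, μ a * y a := by
  set W := ∑ a, μ a with hWdef
  set m := ∑ i, u i with hm
  have hmu : u i₀ ≤ m := Finset.single_le_sum (fun i _ => hu i) (Finset.mem_univ i₀)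
  have hmpos : 0 < m := hu₀.trans_le hmu
  set N : V → ℝ := fun a => ∑ b with ¬ R a b, μ b with hN
  obtain ⟨v, hclique, hmin⟩ := exists_greedy_clique y R (r + 1) (by
    intro v j hj
    by_contra! hcon
    have h1 : W ≤ ∑ i ∈ Finset.range j, N (v i) := by
      simp only [hN, Finset.sum_filter, hWdef]
      rw [Finset.sum_comm]
      refine Finset.sum_le_sum fun b _ => ?_
      obtain ⟨i, hi, hib⟩ := hcon b
      have := Finset.single_le_sum (f := fun i => if ¬ R (v i) b then μ b else 0)
        (fun i _ => by split_ifs <;> simp [hμ]) (Finset.mem_range.2 hi)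
      simpa [hib] using this
    have h2 : (r + 1) * m * W ≤ j * ((m - u i₀) * W) := by
      calc (r + 1) * m * W ≤ (r + 1) * m * ∑ i ∈ Finset.range j, N (v i) := by gcongr
        _ = ∑ i ∈ Finset.range j, (r + 1) * m * N (v i) := by rw [Finset.mul_sum]
        _ ≤ ∑ i ∈ Finset.range j, (m - u i₀) * W := Finset.sum_le_sum fun i _ => hdeg (v i)
        _ = _ := by simp
    have hj' : (j : ℝ) ≤ r + 1 := by exact_mod_cast hj
    have h3 : (j : ℝ) * ((m - u i₀) * W) ≤ (r + 1) * ((m - u i₀) * W) := by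
      have : 0 ≤ (m - u i₀) * W := mul_nonneg (by linarith) hW.le
      gcongr
    have h4 : 0 < (r + 1 : ℝ) * (u i₀ * W) := by positivity
    nlinarith)
  set z := y (v (r + 1)) with hz
  have hmono : ∀ i < r + 1, y (v i) ≤ z := fun i hi =>
    hmin i hi.le _ fun i' hi' => hclique i' _ (by omega) le_rfl
  -- pointwise lower bound for `y`
  have hpt : ∀ a,
      z - ∑ j ∈ Finset.range (r + 1), (if ¬ R (v j) a then z - y (v j) else 0) ≤ y a := by
    intro a
    have hnn : ∀ i ∈ Finset.range (r + 1), 0 ≤ (if ¬ R (v i) a then z - y (v i) else 0) := by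
      intro i hi
      have := hmono i (Finset.mem_range.1 hi)
      split_ifs <;> linarith
    by_cases hall : ∀ i < r + 1, R (v i) a
    · have := hmin (r + 1) le_rfl a hall
      have := Finset.sum_nonneg hnn
      linarith
    · push Not at hall
      have hspec := Nat.find_spec hall
      have hlt : ∀ i < Nat.find hall, R (v i) a := by
        intro i hi
        by_contra hcon
        exact Nat.find_min hall hi ⟨by omega, hcon⟩
      have h1 := hmin (Nat.find hall) (by omega) a hlt
      have h2 := Finset.single_le_sum hnn (Finset.mem_range.2 hspec.1)
      simp only [hspec.2, not_false_eq_true, if_true] at h2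
      linarith
  have hsum : W * z - ∑ j ∈ Finset.range (r + 1), N (v j) * (z - y (v j)) ≤ ∑ a, μ a * y a := by
    calc W * z - ∑ j ∈ Finset.range (r + 1), N (v j) * (z - y (v j))
        = ∑ a, μ a * (z - ∑ j ∈ Finset.range (r + 1),
            (if ¬ R (v j) a then z - y (v j) else 0)) := by
          simp only [mul_sub, Finset.sum_sub_distrib, hWdef, Finset.sum_mul, Finset.mul_sum]
          congr 1
          rw [← Finset.sum_sub_distrib, Finset.sum_comm]
          refine Finset.sum_congr rfl fun j _ => ?_
          simp only [hN, Finset.sum_filter, Finset.sum_mul, ← Finset.sum_sub_distrib]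
          refine Finset.sum_congr rfl fun a _ => ?_
          split_ifs <;> ring
      _ ≤ _ := Finset.sum_le_sum fun a _ => mul_le_mul_of_nonneg_left (hpt a) (hμ a)
  -- averaging the clique constraint over cyclic shifts
  set Y := ∑ j : Fin (r + 1), y (v j) with hY
  have havg : (r + 1 : ℝ) * M ≤ (m - u i₀) * Y + (r + 1) * (u i₀ * z) := by
    have hs : ∀ s : Fin (r + 1),
        M ≤ u i₀ * z + ∑ j : Fin (r + 1), u (i₀.succAbove j) * y (v (j + s : Fin (r + 1))) := by
      intro s
      have := hy (Fin.insertNth i₀ (v (r + 1)) fun j => v (j + s : Fin (r + 1))) ?_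
      · rw [Fin.sum_univ_succAbove _ i₀] at this
        simpa using this
      · have key : ∀ a b : Fin (r + 1), a ≠ b → R (v a) (v b) := by
          intro a b hab
          rcases lt_or_gt_of_ne hab with h | h
          · exact hclique a b h b.2.le
          · exact hsymm _ _ (hclique b a h a.2.le)
        intro i j hij
        induction i using Fin.succAboveCases i₀ with
        | x =>
          induction j using Fin.succAboveCases i₀ with
          | x => exact absurd rfl hij
          | p j =>
            simp only [Fin.insertNth_apply_same, Fin.insertNth_apply_succAbove]
            exact hsymm _ _ (hclique _ _ (Fin.is_lt _) le_rfl)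
        | p i =>
          induction j using Fin.succAboveCases i₀ with
          | x =>
            simp only [Fin.insertNth_apply_same, Fin.insertNth_apply_succAbove]
            exact hclique _ _ (Fin.is_lt _) le_rfl
          | p j =>
            simp only [Fin.insertNth_apply_succAbove]
            refine key _ _ fun h => hij ?_
            rw [add_left_injective s h]
    have := Finset.sum_le_sum fun s (_ : s ∈ Finset.univ) => hs s
    rw [Finset.sum_add_distrib,
      sum_mul_sum_fin_add (fun j => u (i₀.succAbove j)) fun j : Fin (r + 1) => y (v j)] at this
    have hsu : ∑ j : Fin (r + 1), u (i₀.succAbove j) = m - u i₀ := by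
      rw [hm, Fin.sum_univ_succAbove _ i₀]; ring
    rw [hsu] at this
    simp only [Finset.sum_const, Finset.card_univ, Fintype.card_fin, nsmul_eq_mul] at this
    push_cast at this
    linarith
  have hfin : (r + 1) * m * ∑ j ∈ Finset.range (r + 1), N (v j) * (z - y (v j)) ≤
      (m - u i₀) * W * ((r + 1) * z - Y) := by
    have e : (r + 1 : ℝ) * z - Y = ∑ j ∈ Finset.range (r + 1), (z - y (v j)) := by
      rw [Finset.sum_sub_distrib, hY, Finset.sum_range fun j => y (v j)]
      simp
    rw [e, Finset.mul_sum (Finset.range (r + 1)), Finset.mul_sum (Finset.range (r + 1))]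
    refine Finset.sum_le_sum fun j hj => ?_
    have h1 := hmono j (Finset.mem_range.1 hj)
    have h2 := mul_le_mul_of_nonneg_right (hdeg (v j)) (sub_nonneg.2 h1)
    calc _ = (r + 1) * m * N (v j) * (z - y (v j)) := by ring
      _ ≤ _ := h2
  have hr : (0 : ℝ) < r + 1 := by positivity
  have h5 := mul_le_mul_of_nonneg_left hsum (mul_nonneg hr.le hmpos.le)
  have h6 := mul_le_mul_of_nonneg_right havg hW.le
  have h7 : (r + 1) * (M * W) ≤ (r + 1) * (m * ∑ a, μ a * y a) := by nlinarith
  exact le_of_mul_le_mul_left h7 hr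

/-- The ordered cliques on `k` vertices of a relation. -/
abbrev OrdClique {V : Type*} (R : V → V → Prop) (k : ℕ) : Type _ :=
  {c : Fin k → V // ∀ i j, i ≠ j → R (c i) (c j)}

/-- A weighted graph with large neighbourhoods has a perfect fractional tiling with ordered cliques
in which the `i`-th vertex of a clique is used with multiplicity `u i`. -/
lemma exists_fractional_tiling {V : Type*} [Fintype V] [DecidableEq V] [Nonempty V]
    (R : V → V → Prop) [DecidableRel R] (hsymm : ∀ a b, R a b → R b a)
    (μ : V → ℝ) (hμ : ∀ a, 0 ≤ μ a) (hW : 0 < ∑ a, μ a)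
    {r : ℕ} (u : Fin (r + 2) → ℝ) (i₀ : Fin (r + 2)) (hu₀ : 0 < u i₀) (hu : ∀ i, 0 ≤ u i)
    (hdeg : ∀ a, ((r + 1 : ℝ) * ∑ i, u i) * (∑ b with ¬ R a b, μ b) ≤
      ((∑ i, u i) - u i₀) * ∑ b, μ b) :
    ∃ w : OrdClique R (r + 2) → ℝ, (∀ c, 0 ≤ w c) ∧
      (∀ a, ∑ c, ∑ i, (if c.1 i = a then u i * w c else 0) ≤ μ a) ∧
      (∑ i, u i) * ∑ c, w c = ∑ a, μ a := by
  set W := ∑ a, μ a with hWdef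
  set m := ∑ i, u i with hm
  have hmpos : 0 < m := hu₀.trans_le (Finset.single_le_sum (fun i _ => hu i) (Finset.mem_univ i₀))
  let z : OrdClique R (r + 2) → V → ℝ := fun c a => W / m * ∑ i, if c.1 i = a then u i else 0
  let L : (OrdClique R (r + 2) → ℝ) →ₗ[ℝ] (V → ℝ) := Fintype.linearCombination ℝ z
  have hL : Continuous L := L.continuous_of_finiteDimensional
  by_cases hdisj : Disjoint (L '' stdSimplex ℝ (OrdClique R (r + 2))) (Set.Iic μ)
  · exfalso
    obtain ⟨f, α, β, hf1, hαβ, hf2⟩ := geometric_hahn_banach_compact_closed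
      ((convex_stdSimplex ℝ _).linear_image L)
      ((isCompact_stdSimplex ℝ _).image hL) (convex_Iic μ) isClosed_Iic hdisj
    have hfsum : ∀ x : V → ℝ, f x = ∑ a, x a * f (Pi.single a 1) := by
      intro x
      conv_lhs => rw [pi_eq_sum_univ' x]
      simp [map_sum]
    have hneg : ∀ a, f (Pi.single a 1) ≤ 0 := by
      intro a
      by_contra! hpos
      have h0 := hf2 μ Set.self_mem_Iic
      set g := f (Pi.single a 1)
      have h1 := hf2 (μ - ((f μ - β) / g) • Pi.single a 1) (by
        simp only [Set.mem_Iic, sub_le_self_iff]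
        refine smul_nonneg (div_nonneg (by linarith) hpos.le) ?_
        exact Pi.single_nonneg.2 zero_le_one)
      rw [map_sub, map_smul, smul_eq_mul, div_mul_cancel₀ _ hpos.ne'] at h1
      linarith
    have hdual := le_sum_mul_of_forall_clique R hsymm μ hμ hW u i₀ hu₀ hu hdeg
      (fun a => - f (Pi.single a 1)) (m / W * (-α)) (by
        intro c hc
        have h1 := hf1 (z ⟨c, hc⟩) ⟨Pi.single ⟨c, hc⟩ 1, single_mem_stdSimplex ℝ _, by simp [L]⟩
        have h2 : f (z ⟨c, hc⟩) = W / m * ∑ i, u i * f (Pi.single (c i) 1) := by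
          rw [hfsum]
          simp only [z, mul_assoc, ← Finset.mul_sum, Finset.sum_mul]
          rw [Finset.sum_comm]
          simp [ite_mul]
        have h3 : ∑ i, u i * f (Pi.single (c i) 1) = m / W * f (z ⟨c, hc⟩) := by
          rw [h2]; field_simp
        simp only [mul_neg, Finset.sum_neg_distrib, h3]
        have := mul_le_mul_of_nonneg_left h1.le (div_nonneg hmpos.le hW.le)
        linarith)
    have h4 := hf2 μ Set.self_mem_Iic
    rw [hfsum] at h4
    simp only [mul_neg, Finset.sum_neg_distrib] at hdual
    rw [← hWdef, ← hm] at hdual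
    have h5 : m / W * α * W = m * α := by field_simp
    nlinarith
  · obtain ⟨_, ⟨w, hw, rfl⟩, hle⟩ := Set.not_disjoint_iff.1 hdisj
    refine ⟨fun c => W / m * w c, fun c => mul_nonneg (by positivity) (hw.1 c), fun a => ?_, ?_⟩
    · refine le_trans (le_of_eq ?_) (hle a)
      simp only [L, Fintype.linearCombination_apply, z, Finset.sum_apply, Pi.smul_apply,
        smul_eq_mul, Finset.mul_sum]
      refine Finset.sum_congr rfl fun c _ => Finset.sum_congr rfl fun i _ => ?_
      split_ifs <;> ring
    · rw [← Finset.mul_sum, hw.2]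
      field_simp

/-- Embedding of a complete multipartite graph with prescribed part sizes into a family of sets such
that between any two large subsets some vertex has large degree. -/
lemma exists_complete_multipartite {α : Type*} [DecidableEq α] (G : SimpleGraph α)
    [DecidableRel G.Adj] {k : ℕ} (A : Fin k → Finset α) {ε ρ κ : ℝ} (hε : 0 < ε) (hρ : 0 < ρ)
    (hρ' : ρ ≤ 1 / 2) (hκ : k * ε ≤ κ) (hA : ∀ i, 1 ≤ κ * #(A i))
    (hreg : ∀ i j, i ≠ j → ∀ X ⊆ A i, ∀ Y ⊆ A j, ε * #(A i) ≤ #X → ε * #(A j) ≤ #Y →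
      ∃ v ∈ X, ρ * #Y ≤ #{w ∈ Y | G.Adj v w})
    (R : ℕ) (r : Fin k → ℕ) (hr : ∑ i, r i = R) (L : Fin k → Finset α) (hLA : ∀ i, L i ⊆ A i)
    (hL : ∀ i, κ * #(A i) ≤ ρ ^ R * #(L i)) :
    ∃ X : Fin k → Finset α, (∀ i, X i ⊆ L i) ∧ (∀ i, #(X i) = r i) ∧
      ∀ i j, i ≠ j → ∀ x ∈ X i, ∀ y ∈ X j, G.Adj x y := by
  induction R generalizing r L with
  | zero =>
    refine ⟨fun _ => ∅, by simp, fun i => ?_, by simp⟩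
    have := (Finset.sum_eq_zero_iff.1 hr) i (Finset.mem_univ i)
    simp [this]
  | succ R ih =>
    obtain ⟨i, -, hi⟩ : ∃ i ∈ Finset.univ, r i ≠ 0 :=
      Finset.exists_ne_zero_of_sum_ne_zero (by omega)
    have hkpos : (0 : ℝ) < k := by exact_mod_cast i.pos
    have hκpos : 0 < κ := lt_of_lt_of_le (by positivity) hκ
    have hεκ : ε ≤ κ := by
      have : (1 : ℝ) ≤ k := by exact_mod_cast i.pos
      nlinarith
    have hρ1 : ρ ^ R ≤ 1 := pow_le_one₀ hρ.le (by linarith)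
    have hρR : 0 < ρ ^ R := by positivity
    have hρR1 : ρ ^ (R + 1) ≤ 1 / 2 := by rw [pow_succ]; nlinarith
    have hLbig : ∀ j, κ * #(A j) ≤ 1 / 2 * #(L j) := fun j =>
      (hL j).trans (mul_le_mul_of_nonneg_right hρR1 (Nat.cast_nonneg _))
    have hLbig' : ∀ j, ε * #(A j) ≤ #(L j) := fun j => by
      have := hLbig j
      have := mul_le_mul_of_nonneg_right hεκ (Nat.cast_nonneg (α := ℝ) #(A j))
      have : (0 : ℝ) ≤ #(L j) := Nat.cast_nonneg _
      linarith
    let bad : Fin k → Finset α := fun j => {v ∈ L i | (#{w ∈ L j | G.Adj v w} : ℝ) < ρ * #(L j)}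
    have hbad : ∀ j, i ≠ j → (#(bad j) : ℝ) ≤ ε * #(A i) := by
      intro j hij
      by_contra! hcon
      obtain ⟨v, hv, hdeg⟩ := hreg i j hij (bad j) ((Finset.filter_subset _ _).trans (hLA i)) (L j)
        (hLA j) hcon.le (hLbig' j)
      exact absurd hdeg (not_le.2 (Finset.mem_filter.1 hv).2)
    have hAi : (0 : ℝ) < #(A i) := by
      by_contra! hcon
      have := hA i
      nlinarith
    have hcard : (#((Finset.univ.erase i).biUnion bad) : ℝ) < #(L i) := by
      calc (#((Finset.univ.erase i).biUnion bad) : ℝ)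
          ≤ ∑ j ∈ Finset.univ.erase i, (#(bad j) : ℝ) := by
            exact_mod_cast Finset.card_biUnion_le
        _ ≤ ∑ j ∈ Finset.univ.erase i, ε * #(A i) := Finset.sum_le_sum fun j hj =>
            hbad j (Finset.ne_of_mem_erase hj).symm
        _ ≤ k * (ε * #(A i)) := by
            rw [Finset.sum_const, nsmul_eq_mul]
            refine mul_le_mul_of_nonneg_right ?_ (by positivity)
            exact_mod_cast (Finset.card_erase_le).trans (by simp)
        _ ≤ κ * #(A i) := by nlinarith
        _ < #(L i) := by
            have := hLbig i
            have := hA i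
            linarith
    obtain ⟨v, hvL, hv⟩ := Finset.exists_mem_notMem_of_card_lt_card (by exact_mod_cast hcard)
    have hvdeg : ∀ j, i ≠ j → ρ * #(L j) ≤ #{w ∈ L j | G.Adj v w} := by
      intro j hij
      by_contra! hcon
      exact hv (Finset.mem_biUnion.2 ⟨j, Finset.mem_erase.2 ⟨hij.symm, Finset.mem_univ j⟩,
        Finset.mem_filter.2 ⟨hvL, hcon⟩⟩)
    let L' : Fin k → Finset α := fun j => if i = j then (L i).erase v else {w ∈ L j | G.Adj v w}
    obtain ⟨X, hXL, hXr, hX⟩ := ih (Function.update r i (r i - 1)) (by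
        rw [Finset.sum_update_of_mem (Finset.mem_univ i)]
        rw [← Finset.add_sum_erase _ _ (Finset.mem_univ i)] at hr
        rw [Finset.sdiff_singleton_eq_erase]
        omega) L' (by
        intro j
        by_cases hij : i = j
        · subst hij
          simpa [L'] using (Finset.erase_subset _ _).trans (hLA i)
        · simpa [L', hij] using (Finset.filter_subset _ _).trans (hLA j)) (by
        intro j
        refine (hL j).trans ?_
        rw [pow_succ, mul_assoc]
        refine mul_le_mul_of_nonneg_left ?_ hρR.le
        by_cases hij : i = j
        · subst hij
          simp only [L', if_true]
          rw [Finset.cast_card_erase_of_mem hvL]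
          have := hLbig i
          have := hA i
          nlinarith
        · simpa [L', hij] using hvdeg j hij)
    have hXi : ∀ x ∈ X i, x ∈ L i ∧ x ≠ v := fun x hx => by
      have := hXL i hx
      simp only [L', if_true, Finset.mem_erase] at this
      exact this.symm
    have hXj : ∀ j, i ≠ j → ∀ x ∈ X j, x ∈ L j ∧ G.Adj v x := fun j hij x hx => by
      have := hXL j hx
      simpa [L', hij] using this
    refine ⟨Function.update X i (insert v (X i)), fun j => ?_, fun j => ?_,
      fun a b hab x hx y hy => ?_⟩
    · by_cases hij : j = i
      · subst hij
        rw [Function.update_self]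
        exact Finset.insert_subset hvL fun x hx => (hXi x hx).1
      · rw [Function.update_of_ne hij]
        exact fun x hx => (hXj j (Ne.symm hij) x hx).1
    · by_cases hij : j = i
      · subst hij
        rw [Function.update_self, Finset.card_insert_of_notMem fun h => (hXi v h).2 rfl, hXr,
          Function.update_self]
        omega
      · rw [Function.update_of_ne hij, hXr, Function.update_of_ne hij]
    · by_cases ha : a = i
      · subst ha
        rw [Function.update_self, Finset.mem_insert] at hx
        rw [Function.update_of_ne hab.symm] at hy
        rcases hx with rfl | hx
        · exact (hXj b hab y hy).2
        · exact hX a b hab x hx y hy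
      · rw [Function.update_of_ne ha] at hx
        by_cases hb : b = i
        · subst hb
          rw [Function.update_self, Finset.mem_insert] at hy
          rcases hy with rfl | hy
          · exact (hXj a hab.symm x hx).2.symm
          · exact hX a b hab x hx y hy
        · rw [Function.update_of_ne hb] at hy
          exact hX a b hab x hx y hy

/-- Finitely many large finite sets contain subsets of prescribed sizes which occupy consecutive
intervals, in some order. -/
lemma exists_separated_subsets {ι : Type*} [DecidableEq ι] {n : ℕ} (s : ι → ℕ) (I : Finset ι)
    (hs : ∀ i ∈ I, 0 < s i) (L : ι → Finset (Fin n)) (hL : ∀ i ∈ I, #I * s i ≤ #(L i)) :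
    ∃ (rk : ι → ℕ) (L' : ι → Finset (Fin n)), Set.InjOn rk I ∧
      (∀ i ∈ I, L' i ⊆ L i ∧ s i ≤ #(L' i)) ∧
      ∀ i ∈ I, ∀ j ∈ I, rk i < rk j → ∀ x ∈ L' i, ∀ y ∈ L' j, x < y := by
  induction hI : #I generalizing I L with
  | zero =>
    rw [Finset.card_eq_zero] at hI
    subst hI
    exact ⟨fun _ => 0, fun _ => ∅, by simp, by simp, by simp⟩
  | succ c ih =>
    have hne : I.Nonempty := Finset.card_pos.1 (by omega)
    have hex : ∃ a : ℕ, ∃ i ∈ I, s i ≤ #{x ∈ L i | x.val < a} := by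
      obtain ⟨i, hi⟩ := hne
      refine ⟨n, i, hi, ?_⟩
      rw [Finset.filter_true_of_mem fun x _ => x.2]
      refine le_trans ?_ (hL i hi)
      rw [hI]
      exact Nat.le_mul_of_pos_left _ (Nat.succ_pos c)
    classical
    obtain ⟨i, hi, hia⟩ := Nat.find_spec hex
    set a := Nat.find hex with ha
    have hapos : a ≠ 0 := by
      intro h0
      have := hs i hi
      rw [h0] at hia
      simp at hia
      omega
    have hsmall : ∀ j ∈ I, #{x ∈ L j | x.val < a} ≤ s j := by
      intro j hj
      have hmin := Nat.find_min hex (m := a - 1) (by omega)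
      push Not at hmin
      have h1 := hmin j hj
      have h2 : #{x ∈ L j | x.val < a} ≤ #{x ∈ L j | x.val < a - 1} + 1 := by
        have hsub : {x ∈ L j | x.val < a} ⊆
            {x ∈ L j | x.val < a - 1} ∪ {x ∈ L j | x.val = a - 1} := by
          intro x hx
          simp only [Finset.mem_union, Finset.mem_filter] at hx ⊢
          have := hx.2
          rcases Nat.lt_or_ge (x : ℕ) (a - 1) with h | h
          · exact Or.inl ⟨hx.1, h⟩
          · exact Or.inr ⟨hx.1, by omega⟩
        refine (Finset.card_le_card hsub).trans ((Finset.card_union_le _ _).trans ?_)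
        gcongr
        refine Finset.card_le_one.2 fun x hx y hy => ?_
        simp only [Finset.mem_filter] at hx hy
        exact Fin.ext (hx.2.trans hy.2.symm)
      omega
    have hI' : #(I.erase i) = c := by rw [Finset.card_erase_of_mem hi, hI]; rfl
    obtain ⟨rk, L', hinj, hsub, hsep⟩ :=
      ih (I.erase i) (fun j hj => hs j (Finset.mem_of_mem_erase hj))
      (fun j => {x ∈ L j | ¬ x.val < a}) (by
        intro j hj
        have hj := Finset.mem_of_mem_erase hj
        have h1 := Finset.card_filter_add_card_filter_not (s := L j) (fun x => x.val < a)
        have h2 := hsmall j hj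
        have h3 := hL j hj
        rw [hI, add_mul, one_mul] at h3
        rw [hI']
        omega) hI'
    refine ⟨fun j => if j = i then 0 else rk j + 1,
      fun j => if j = i then {x ∈ L i | x.val < a} else L' j, ?_, ?_, ?_⟩
    · intro j hj j' hj' h
      by_cases h1 : j = i <;> by_cases h2 : j' = i
      · rw [h1, h2]
      · simp [h1, h2] at h
      · simp [h1, h2] at h
      · simp only [h1, h2, if_false, Nat.add_right_cancel_iff] at h
        exact hinj (Finset.mem_coe.2 (Finset.mem_erase.2 ⟨h1, hj⟩))
          (Finset.mem_coe.2 (Finset.mem_erase.2 ⟨h2, hj'⟩)) h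
    · intro j hj
      by_cases h1 : j = i
      · subst h1
        simpa using hia
      · simp only [h1, if_false]
        have := hsub j (Finset.mem_erase.2 ⟨h1, hj⟩)
        exact ⟨this.1.trans (Finset.filter_subset _ _), this.2⟩
    · intro j hj j' hj' hlt x hx y hy
      by_cases h2 : j' = i
      · simp [h2] at hlt
      have hj'' := Finset.mem_erase.2 ⟨h2, hj'⟩
      simp only [h2, if_false] at hy hlt
      by_cases h1 : j = i
      · simp only [h1, if_true, Finset.mem_filter] at hx
        have := (Finset.mem_filter.1 ((hsub j' hj'').1 hy)).2
        exact Fin.lt_def.2 (by omega)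
      · simp only [h1, if_false] at hx hlt
        exact hsep j (Finset.mem_erase.2 ⟨h1, hj⟩) j' hj'' (by omega) x hx y hy

lemma HasPerfectTilingOn.union {h n : ℕ} {H : SimpleGraph (Fin h)} {G : SimpleGraph (Fin n)}
    {S S' : Finset (Fin n)} (hS : HasPerfectTilingOn H G S) (hS' : HasPerfectTilingOn H G S')
    (hd : Disjoint S S') : HasPerfectTilingOn H G (S ∪ S') := by
  obtain ⟨T, h1, h2, rfl⟩ := hS
  obtain ⟨T', h1', h2', rfl⟩ := hS'
  refine ⟨T ∪ T', fun t ht => ?_, ?_, ?_⟩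
  · rcases Finset.mem_union.1 ht with ht | ht
    exacts [h1 t ht, h1' t ht]
  · rw [Finset.coe_union]
    refine h2.union h2' fun a ha b hb _ => ?_
    exact hd.mono (Finset.subset_biUnion_of_mem id ha) (Finset.subset_biUnion_of_mem id hb)
  · ext x
    simp only [Finset.mem_biUnion, Finset.mem_union, or_and_right, exists_or]

lemma HasPerfectTiling.map {h N n : ℕ} {H : SimpleGraph (Fin h)} {G' : SimpleGraph (Fin N)}
    {G : SimpleGraph (Fin n)} (hT : HasPerfectTiling H G') (e : Fin N ↪o Fin n)
    (he : ∀ u v, G'.Adj u v → G.Adj (e u) (e v)) :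
    HasPerfectTilingOn H G (Finset.univ.map e.toEmbedding) := by
  obtain ⟨T, h1, h2, h3⟩ := hT
  refine ⟨T.image fun t => t.map e.toEmbedding, fun t' ht' => ?_, ?_, ?_⟩
  · obtain ⟨t, ht, rfl⟩ := Finset.mem_image.1 ht'
    obtain ⟨φ, ⟨hmono, hadj⟩, rfl⟩ := h1 t ht
    refine ⟨fun i => e (φ i), ⟨e.strictMono.comp hmono, fun i j hij => he _ _ (hadj i j hij)⟩, ?_⟩
    rw [Finset.map_eq_image, Finset.image_image]
    rfl
  · rintro a' ha' b' hb' hab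
    obtain ⟨a, ha, rfl⟩ := Finset.mem_image.1 (Finset.mem_coe.1 ha')
    obtain ⟨b, hb, rfl⟩ := Finset.mem_image.1 (Finset.mem_coe.1 hb')
    exact (Finset.disjoint_map _).2 (h2 ha hb fun h => hab (by rw [h]))
  · rw [← h3]
    ext x
    simp only [Finset.mem_biUnion, Finset.mem_image, Finset.mem_map, id]
    aesop

/-- A monotone function on `Fin N` is determined by the sizes of its fibres. -/
lemma Monotone.eq_of_card_fiber_eq {N k : ℕ} {f g : Fin N → Fin k} (hf : Monotone f)
    (hg : Monotone g) (hfg : ∀ i, #{u | f u = i} = #{u | g u = i}) : f = g := by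
  have hle : ∀ (f : Fin N → Fin k) (i : Fin k),
      #{u | f u ≤ i} = ∑ j ∈ Finset.Iic i, #{u | f u = j} := by
    intro f i
    rw [Finset.card_eq_sum_card_fiberwise (f := f) (t := Finset.Iic i)
      (by intro u hu; simpa using hu)]
    refine Finset.sum_congr rfl fun j hj => ?_
    rw [Finset.filter_filter]
    congr 1
    ext u
    simp only [Finset.mem_filter, Finset.mem_univ, true_and, and_iff_right_iff_imp]
    rintro rfl
    simpa using hj
  have key : ∀ f g : Fin N → Fin k, Monotone f → Monotone g →
      (∀ i, #{u | f u = i} = #{u | g u = i}) → ∀ u, g u ≤ f u := by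
    intro f g hf hg hfg u
    by_contra! hlt
    have h1 : #{v | f v ≤ f u} = #{v | g v ≤ f u} := by
      rw [hle, hle]
      exact Finset.sum_congr rfl fun j _ => hfg j
    have h2 : Finset.Iic u ⊆ ({v | f v ≤ f u} : Finset (Fin N)) := fun v hv => by
      simpa using hf (Finset.mem_Iic.1 hv)
    have h3 : ({v | g v ≤ f u} : Finset (Fin N)) ⊆ Finset.Iio u := fun v hv => by
      rw [Finset.mem_Iio]
      by_contra! hcon
      exact absurd ((hg hcon).trans (Finset.mem_filter.1 hv).2) (not_le.2 hlt)
    have h4 := Finset.card_le_card h2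
    have h5 := Finset.card_le_card h3
    rw [Fin.card_Iic] at h4
    rw [Fin.card_Iio] at h5
    omega
  funext u
  exact le_antisymm (key g f hg hf (fun i => (hfg i).symm) u) (key f g hf hg hfg u)

lemma card_filter_divNat_eq {m t : ℕ} (x : Fin m) : #{u : Fin (m * t) | u.divNat = x} = t := by
  have : ({u : Fin (m * t) | u.divNat = x} : Finset _) =
      (Finset.univ : Finset (Fin t)).map
        ⟨fun y => finProdFinEquiv (x, y), fun a b hab => by simpa using hab⟩ := by
    ext u
    simp only [Finset.mem_filter, Finset.mem_univ, true_and, Finset.mem_map]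
    constructor
    · rintro rfl
      exact ⟨u.modNat, finProdFinEquiv.apply_symm_apply u⟩
    · rintro ⟨y, rfl⟩
      exact congrArg Prod.fst (finProdFinEquiv.symm_apply_apply (x, y))
  rw [this, Finset.card_map, Finset.card_univ, Fintype.card_fin]

/-- A complete multipartite subgraph whose parts are ordered intervals with the part sizes of an
ordered blow-up inherits a perfect tiling from that blow-up. -/
lemma hasPerfectTilingOn_of_separated {h m k n : ℕ} {H : SimpleGraph (Fin h)} {p : Fin m → Fin k}
    {G : SimpleGraph (Fin n)} {φ : Equiv.Perm (Fin m)} {σ : Equiv.Perm (Fin k)}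
    (hφ : ∀ x y, σ (p x) < σ (p y) → φ x < φ y) {t : ℕ}
    (ht : ∀ (N : ℕ) (G' : SimpleGraph (Fin N)), IsOrderedBlowup p φ t G' → HasPerfectTiling H G')
    (X : Fin k → Finset (Fin n)) (hX : ∀ i, #(X i) = t * #{x | p x = i})
    (hsep : ∀ i j, σ i < σ j → ∀ x ∈ X i, ∀ y ∈ X j, x < y)
    (hcomp : ∀ i j, i ≠ j → ∀ x ∈ X i, ∀ y ∈ X j, G.Adj x y) :
    HasPerfectTilingOn H G (Finset.univ.biUnion X) := by
  have hdisj : ∀ i j, i ≠ j → Disjoint (X i) (X j) := by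
    intro i j hij
    rw [Finset.disjoint_left]
    intro x hx hx'
    exact G.loopless.irrefl x (hcomp i j hij x hx x hx')
  have hcard : #(Finset.univ.biUnion X) = m * t := by
    rw [Finset.card_biUnion fun i _ j _ hij => hdisj i j hij]
    simp only [hX, ← Finset.mul_sum]
    rw [← Finset.card_eq_sum_card_fiberwise (f := p) (by intro x _; simp)]
    simp [mul_comm]
  set U := Finset.univ.biUnion X with hU
  let e := U.orderEmbOfFin hcard
  let β : Fin (m * t) → Fin m := fun u => φ.symm u.divNat
  have hβ : ∀ u, φ (β u) = u.divNat := fun u => φ.apply_symm_apply _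
  have hβcard : ∀ x, #{u | β u = x} = t := by
    intro x
    refine Eq.trans (congrArg _ ?_) (card_filter_divNat_eq (t := t) (φ x))
    ext u
    simp [β, Equiv.symm_apply_eq]
  have hex : ∀ u, ∃ i, e u ∈ X i := by
    intro u
    have : e u ∈ U := Finset.orderEmbOfFin_mem U hcard u
    simpa [hU] using this
  choose f hf using hex
  have hfmono : Monotone fun u => σ (f u) := by
    intro u v huv
    by_contra! hlt
    exact absurd (hsep _ _ hlt _ (hf v) _ (hf u)) (not_lt.2 (e.monotone huv))
  have hgmono : Monotone fun u => σ (p (β u)) := by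
    intro u v huv
    by_contra! hlt
    have h1 := hφ _ _ hlt
    rw [hβ, hβ, Fin.lt_def, Fin.coe_divNat, Fin.coe_divNat] at h1
    exact absurd (Nat.div_le_div_right (c := t) (Fin.le_def.1 huv)) (not_le.2 h1)
  have hfi : ∀ i, #{u | f u = i} = t * #{x | p x = i} := by
    intro i
    rw [← hX, ← Finset.card_map e.toEmbedding]
    congr 1
    ext x
    simp only [Finset.mem_map, Finset.mem_filter, Finset.mem_univ, true_and]
    constructor
    · rintro ⟨u, rfl, rfl⟩
      exact hf u
    · intro hx
      have hxU : x ∈ (U : Set (Fin n)) := by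
        simp only [hU, Finset.coe_biUnion, Set.mem_iUnion]
        exact ⟨i, by simp, hx⟩
      rw [← Finset.range_orderEmbOfFin U hcard] at hxU
      obtain ⟨u, rfl⟩ := hxU
      refine ⟨u, ?_, rfl⟩
      by_contra hne
      exact Finset.disjoint_left.1 (hdisj _ _ hne) (hf u) hx
  have hgi : ∀ i, #{u | p (β u) = i} = t * #{x | p x = i} := by
    intro i
    rw [Finset.card_eq_sum_card_fiberwise (f := β) (t := {x | p x = i})
      (by intro u hu; simpa using hu)]
    have : ∀ x ∈ ({x | p x = i} : Finset (Fin m)),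
        #{u ∈ ({u | p (β u) = i} : Finset (Fin (m * t))) | β u = x} = t := by
      intro x hx
      rw [Finset.filter_filter]
      refine Eq.trans (congrArg _ ?_) (hβcard x)
      ext u
      simp only [Finset.mem_filter, Finset.mem_univ, true_and, and_iff_right_iff_imp]
      rintro rfl
      simpa using hx
    rw [Finset.sum_congr rfl this, Finset.sum_const, smul_eq_mul, mul_comm]
  have hfg : ∀ u, f u = p (β u) := by
    have := hfmono.eq_of_card_fiber_eq hgmono fun i => by
      have h1 := hfi (σ.symm i)
      rw [← hgi] at h1
      simpa [← Equiv.eq_symm_apply] using h1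
    exact fun u => σ.injective (congrFun this u)
  have hblow : IsOrderedBlowup p φ t (SimpleGraph.comap (fun u => p (β u)) ⊤) := by
    refine ⟨β, fun x => ?_, fun u v huv => ?_, fun u v => ?_⟩
    · refine Eq.trans ?_ (hβcard x)
      rw [← Set.ncard_coe_finset]
      simp
    · rw [hβ, hβ, Fin.le_def, Fin.coe_divNat, Fin.coe_divNat]
      exact Nat.div_le_div_right huv
    · simp
  have := (ht _ _ hblow).map (G := G) e (by
    intro u v huv
    have huv : p (β u) ≠ p (β v) := by simpa using huv
    rw [← hfg, ← hfg] at huv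
    exact hcomp _ _ huv _ (hf u) _ (hf v))
  convert this using 1
  apply Finset.coe_injective
  rw [Finset.coe_map, Finset.coe_univ, Set.image_univ]
  exact (Finset.range_orderEmbOfFin U hcard).symm

/-- The critical chromatic number of a complete multipartite graph is computed by one of its
parts. -/
lemma exists_part_one_div_critChrom {m k : ℕ} (p : Fin m → Fin k) (hk : 2 ≤ k)
    (hparts : ∀ i : Fin k, ∃ x : Fin m, p x = i) :
    ∃ i₀ : Fin k, 1 / critChrom (SimpleGraph.comap p (⊤ : SimpleGraph (Fin k))) =
      ((m : ℝ) - #{x | p x = i₀}) / ((k - 1) * m) := by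
  set B := SimpleGraph.comap p (⊤ : SimpleGraph (Fin k)) with hB
  choose f hf using hparts
  have hadj : ∀ x y, B.Adj x y ↔ p x ≠ p y := by simp [hB]
  have hinj : ∀ (l : ℕ) (C : Fin m → Fin l), (∀ x y, B.Adj x y → C x ≠ C y) →
      Function.Injective fun i => C (f i) := by
    intro l C hC i j hij
    by_contra hne
    exact hC (f i) (f j) (by rw [hadj, hf, hf]; exact hne) hij
  have hchi : chromNum B = k := by
    refine le_antisymm (Nat.sInf_le ⟨p, fun x y h => (hadj x y).1 h⟩) ?_
    refine le_csInf ⟨k, p, fun x y h => (hadj x y).1 h⟩ ?_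
    rintro l ⟨C, hC⟩
    simpa using Fintype.card_le_of_injective _ (hinj l C hC)
  have hpos : 0 < k := by omega
  have hmem : sigmaMinCl B ∈ {c | ∃ C : Fin m → Fin (chromNum B),
      (∀ x y : Fin m, B.Adj x y → C x ≠ C y) ∧
      ∃ i : Fin (chromNum B), c = (Finset.univ.filter (fun v => C v = i)).card} := by
    refine Nat.sInf_mem ⟨#{v | p v = ⟨0, hpos⟩}, ?_⟩
    rw [hchi]
    exact ⟨p, fun x y h => (hadj x y).1 h, ⟨0, hpos⟩, by simp⟩
  rw [hchi] at hmem
  obtain ⟨C, hC, i, hi⟩ := hmem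
  have hbij : Function.Bijective fun i => C (f i) :=
    Finite.injective_iff_bijective.1 (hinj k C hC)
  obtain ⟨j, hj⟩ := hbij.2 i
  have hj : C (f j) = i := hj
  have hfib : #{v | C v = i} = #{x | p x = j} := by
    congr 1
    ext v
    simp only [Finset.mem_filter, Finset.mem_univ, true_and]
    constructor
    · intro hv
      by_contra hne
      exact hC v (f j) ((hadj _ _).2 (by rw [hf]; exact hne)) (by rw [hv, hj])
    · intro hv
      obtain ⟨j', hj'⟩ := hbij.2 (C v)
      have hj' : C (f j') = C v := hj'
      have : p v = j' := by
        by_contra hne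
        exact hC (f j') v ((hadj _ _).2 (by rw [hf]; exact fun h => hne h.symm)) hj'
      rw [← hj', ← this, hv, hj]
  refine ⟨j, ?_⟩
  rw [critChrom, hchi, hi, hfib, one_div_div]

/-- Adjacency in the reduced graph of a regularity partition. -/
def ReducedAdj {α : Type*} [DecidableEq α] (G : SimpleGraph α) [DecidableRel G.Adj] (ε d : ℝ)
    (A B : Finset α) : Prop :=
  A ≠ B ∧ G.IsUniform ε A B ∧ d ≤ (G.edgeDensity A B : ℝ)

lemma ReducedAdj.symm {α : Type*} [DecidableEq α] {G : SimpleGraph α} [DecidableRel G.Adj]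
    {ε d : ℝ} {A B : Finset α} (h : ReducedAdj G ε d A B) : ReducedAdj G ε d B A :=
  ⟨h.1.symm, h.2.1.symm, by rw [G.edgeDensity_comm]; exact h.2.2⟩

lemma card_interedges_eq_sum {α : Type*} [DecidableEq α] (G : SimpleGraph α) [DecidableRel G.Adj]
    (X Y : Finset α) : #(G.interedges X Y) = ∑ v ∈ X, #{w ∈ Y | G.Adj v w} := by
  rw [SimpleGraph.interedges_def, Finset.card_filter, Finset.sum_product]
  simp only [Finset.card_filter]

lemma ReducedAdj.exists_le_card_filter {α : Type*} [DecidableEq α] {G : SimpleGraph α}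
    [DecidableRel G.Adj] {ε d ρ : ℝ} {A B : Finset α} (h : ReducedAdj G ε d A B)
    (hd : ρ + ε ≤ d) {X Y : Finset α} (hX : X ⊆ A) (hY : Y ⊆ B) (hX0 : X.Nonempty)
    (hXA : ε * #A ≤ #X) (hYB : ε * #B ≤ #Y) : ∃ v ∈ X, ρ * #Y ≤ #{w ∈ Y | G.Adj v w} := by
  have hu := h.2.1 hX hY (by rwa [mul_comm]) (by rwa [mul_comm])
  have hdens : ρ < (G.edgeDensity X Y : ℝ) := by
    have := (abs_lt.1 hu).1
    linarith [h.2.2]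
  rcases Y.eq_empty_or_nonempty with rfl | hY0
  · obtain ⟨v, hv⟩ := hX0
    exact ⟨v, hv, by simp⟩
  by_contra! hcon
  have h1 : (#(G.interedges X Y) : ℝ) ≤ #X * (ρ * #Y) := by
    rw [card_interedges_eq_sum, Nat.cast_sum, ← nsmul_eq_mul]
    exact Finset.sum_le_card_nsmul _ _ _ fun v hv => (hcon v hv).le
  have hXp : (0 : ℝ) < #X := by exact_mod_cast hX0.card_pos
  have hYp : (0 : ℝ) < #Y := by exact_mod_cast hY0.card_pos
  rw [SimpleGraph.edgeDensity_def] at hdens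
  push_cast at hdens
  rw [lt_div_iff₀ (by positivity)] at hdens
  nlinarith

open Classical in
/-- The degree form of the regularity lemma, with clusters irregular to many others discarded. -/
lemma exists_regular_clusters {η ε : ℝ} (hη : 0 < η) (hε : 0 < ε)
    (hεη : 64 * ε ≤ η ^ 2) :
    ∃ K n₁ : ℕ, 0 < K ∧ ∀ n : ℕ, n₁ ≤ n → ∀ (G : SimpleGraph (Fin n)) (D : ℝ),
      (∀ v, (D + η) * n ≤ G.degree v) →
      ∃ 𝒱 : Finset (Finset (Fin n)), (𝒱 : Set (Finset (Fin n))).PairwiseDisjoint id ∧ #𝒱 ≤ K ∧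
        (∀ A ∈ 𝒱, n ≤ 2 * K * #A) ∧ (1 - η / 4) * n ≤ ∑ A ∈ 𝒱, (#A : ℝ) ∧
        ∀ A ∈ 𝒱, D * n ≤ ∑ B ∈ 𝒱 with ReducedAdj G ε (η / 8) A B, (#B : ℝ) := by
  set l := ⌈16 / η⌉₊ with hl
  refine ⟨SzemerediRegularity.bound ε l, l + 1, SzemerediRegularity.bound_pos _ _,
    fun n hn G D hdeg => ?_⟩
  have hlη : 16 ≤ η * l := by
    have := Nat.le_ceil (16 / η)
    rw [div_le_iff₀ hη] at this
    linarith
  have hnl : (l : ℝ) + 1 ≤ n := by exact_mod_cast hn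
  have hnη : 16 ≤ η * n := by nlinarith
  have hn0 : (0 : ℝ) < n := by
    have : (0 : ℝ) ≤ l := Nat.cast_nonneg _
    linarith
  obtain ⟨P, hPeq, hPl, hPK, hPu⟩ := szemeredi_regularity G (l := l) hε (by simp; omega)
  have : Nonempty (Fin n) := ⟨⟨0, by omega⟩⟩
  have hPsum : ∑ B ∈ P.parts, (#B : ℝ) = n := by
    have := P.sum_card_parts
    rw [Finset.card_univ, Fintype.card_fin] at this
    exact_mod_cast this
  have hPpos : 0 < #P.parts := by
    have : l ≠ 0 := by
      intro h0
      rw [h0] at hlη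
      norm_num at hlη
    omega
  have hirr := hPeq.sum_nonUniforms_lt' (ε := ε) (G := G) Finset.univ_nonempty hε hPu
  rw [Finset.card_univ, Fintype.card_fin] at hirr
  have hPn : (#P.parts : ℝ) ≤ n := by
    have := P.card_parts_le_card
    rw [Finset.card_univ, Fintype.card_fin] at this
    exact_mod_cast this
  let irr : Finset (Fin n) → ℝ := fun A => ∑ B ∈ P.parts with A ≠ B ∧ ¬ G.IsUniform ε A B, (#B : ℝ)
  have hirr' : ∑ A ∈ P.parts, (#A : ℝ) * irr A < 4 * ε * n ^ 2 := by
    have e : ∑ A ∈ P.parts, (#A : ℝ) * irr A = ∑ i ∈ P.nonUniforms G ε, (#i.1 * #i.2 : ℝ) := by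
      have : P.nonUniforms G ε =
          {i ∈ P.parts ×ˢ P.parts | i.1 ≠ i.2 ∧ ¬ G.IsUniform ε i.1 i.2} := by
        ext ⟨A, B⟩
        simp only [Finpartition.mk_mem_nonUniforms, Finset.mem_filter, Finset.mem_product]
        tauto
      rw [this, Finset.sum_filter, Finset.sum_product]
      refine Finset.sum_congr rfl fun A _ => ?_
      simp only [irr, Finset.mul_sum, Finset.sum_filter]
      refine Finset.sum_congr rfl fun B _ => ?_
      split_ifs <;> simp
    rw [e]
    refine hirr.trans_le ?_
    have : ((n : ℝ) + #P.parts) ^ 2 ≤ (n + n) ^ 2 := by gcongr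
    nlinarith
  let good : Finset (Fin n) → Prop := fun A => irr A ≤ η / 4 * n
  have hbad : ∑ A ∈ P.parts with ¬ good A, (#A : ℝ) ≤ η / 4 * n := by
    have h1 : (∑ A ∈ P.parts with ¬ good A, (#A : ℝ)) * (η / 4 * n) ≤
        ∑ A ∈ P.parts, (#A : ℝ) * irr A := by
      rw [Finset.sum_mul]
      refine (Finset.sum_le_sum fun A hA => ?_).trans
        (Finset.sum_le_sum_of_subset_of_nonneg (Finset.filter_subset _ _) fun A _ _ => ?_)
      · have := (Finset.mem_filter.1 hA).2
        exact mul_le_mul_of_nonneg_left (not_le.1 this).le (Nat.cast_nonneg _)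
      · exact mul_nonneg (Nat.cast_nonneg _) (Finset.sum_nonneg fun _ _ => Nat.cast_nonneg _)
    have h2 : (∑ A ∈ P.parts with ¬ good A, (#A : ℝ)) * (η / 4 * n) ≤
        (η / 4 * n) * (η / 4 * n) := by nlinarith [sq_nonneg (n : ℝ)]
    exact le_of_mul_le_mul_right h2 (by positivity)
  refine ⟨P.parts.filter good, ?_, ?_, ?_, ?_, ?_⟩
  · exact P.disjoint.subset (Finset.coe_subset.2 (Finset.filter_subset _ _))
  · exact (Finset.card_filter_le _ _).trans hPK
  · intro A hA
    have hA := (Finset.mem_filter.1 hA).1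
    have h1 := hPeq.average_le_card_part hA
    rw [Finset.card_univ, Fintype.card_fin] at h1
    have h2 : 0 < #A := (P.nonempty_of_mem_parts hA).card_pos
    have h3 : n < #P.parts * (n / #P.parts + 1) := Nat.lt_mul_div_succ n hPpos
    calc n ≤ #P.parts * (n / #P.parts + 1) := h3.le
      _ ≤ SzemerediRegularity.bound ε l * (2 * #A) := Nat.mul_le_mul hPK (by omega)
      _ = _ := by ring
  · have := Finset.sum_filter_add_sum_filter_not P.parts good fun A => (#A : ℝ)
    rw [hPsum] at this
    linarith
  · intro A hA
    obtain ⟨hA, hgood⟩ := Finset.mem_filter.1 hA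
    have hApos : (0 : ℝ) < #A := by exact_mod_cast (P.nonempty_of_mem_parts hA).card_pos
    have hAsmall : (#A : ℝ) ≤ η / 8 * n := by
      have h1 := hPeq.card_part_le_average_add_one hA
      rw [Finset.card_univ, Fintype.card_fin] at h1
      have h2 : (#A : ℝ) ≤ (n / #P.parts : ℕ) + 1 := by exact_mod_cast h1
      have h3 : ((n / #P.parts : ℕ) : ℝ) * l ≤ n := by
        calc ((n / #P.parts : ℕ) : ℝ) * l ≤ (n / #P.parts : ℕ) * #P.parts := by gcongr
          _ ≤ n := by exact_mod_cast Nat.div_mul_le_self _ _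
      have h4 : ((n / #P.parts : ℕ) : ℝ) * 16 ≤ η * n := by
        calc ((n / #P.parts : ℕ) : ℝ) * 16 ≤ (n / #P.parts : ℕ) * (η * l) := by gcongr
          _ = η * ((n / #P.parts : ℕ) * l) := by ring
          _ ≤ η * n := by gcongr
      linarith
    have hdegsum : (#A : ℝ) * ((D + η) * n) ≤ ∑ B ∈ P.parts, (#(G.interedges A B) : ℝ) := by
      have h1 : ∑ B ∈ P.parts, #(G.interedges A B) = ∑ v ∈ A, G.degree v := by
        simp only [card_interedges_eq_sum]
        rw [Finset.sum_comm]
        refine Finset.sum_congr rfl fun v _ => ?_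
        rw [← SimpleGraph.card_neighborFinset_eq_degree, SimpleGraph.neighborFinset_eq_filter]
        conv_rhs => rw [← P.biUnion_parts, Finset.filter_biUnion]
        rw [Finset.card_biUnion]
        · rfl
        · intro B hB B' hB' hne
          exact Finset.disjoint_filter_filter (P.disjoint hB hB' hne)
      rw [← Nat.cast_sum, h1, Nat.cast_sum, ← nsmul_eq_mul]
      exact Finset.card_nsmul_le_sum _ _ _ fun v _ => hdeg v
    have hterm : ∀ B ∈ P.parts, (#(G.interedges A B) : ℝ) ≤
        #A * ((if good B ∧ ReducedAdj G ε (η / 8) A B then (#B : ℝ) else 0) + η / 8 * #B +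
          (if A = B then (#B : ℝ) else 0) +
          (if A ≠ B ∧ ¬ G.IsUniform ε A B then (#B : ℝ) else 0) +
          (if ¬ good B then (#B : ℝ) else 0)) := by
      intro B hB
      have hBpos : (0 : ℝ) < #B := by exact_mod_cast (P.nonempty_of_mem_parts hB).card_pos
      have htriv : (#(G.interedges A B) : ℝ) ≤ #A * #B := by
        exact_mod_cast G.card_interedges_le_mul A B
      by_cases h1 : (good B ∧ ReducedAdj G ε (η / 8) A B) ∨ A = B ∨
          (A ≠ B ∧ ¬ G.IsUniform ε A B) ∨ ¬ good B
      · refine htriv.trans (mul_le_mul_of_nonneg_left ?_ hApos.le)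
        have hηB : 0 ≤ η / 8 * (#B : ℝ) := by positivity
        rcases h1 with h | h | h | h
        · rw [if_pos h]; split_ifs <;> linarith
        · rw [if_pos h]; split_ifs <;> linarith
        · rw [if_pos h]; split_ifs <;> linarith
        · rw [if_pos h]; split_ifs <;> linarith
      · push Not at h1
        have hun : G.IsUniform ε A B := h1.2.2.1 h1.2.1
        have hdens : (G.edgeDensity A B : ℝ) < η / 8 := by
          by_contra! hcon
          exact h1.1 h1.2.2.2 ⟨h1.2.1, hun, hcon⟩
        rw [SimpleGraph.edgeDensity_def] at hdens
        push_cast at hdens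
        rw [div_lt_iff₀ (by positivity)] at hdens
        have : (#(G.interedges A B) : ℝ) ≤ #A * (η / 8 * #B) := by nlinarith
        refine this.trans (mul_le_mul_of_nonneg_left ?_ hApos.le)
        have : (0 : ℝ) ≤ #B := hBpos.le
        split_ifs <;> linarith
    have htot := hdegsum.trans (Finset.sum_le_sum hterm)
    rw [← Finset.mul_sum] at htot
    have htot := le_of_mul_le_mul_left htot hApos
    simp only [Finset.sum_add_distrib, ← Finset.sum_filter, ← Finset.mul_sum, hPsum] at htot
    have hAA : ∑ B ∈ P.parts with A = B, (#B : ℝ) = #A := by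
      rw [Finset.filter_eq, if_pos hA, Finset.sum_singleton]
    rw [hAA] at htot
    rw [Finset.filter_filter]
    have hg : irr A ≤ η / 4 * n := hgood
    have hirrdef : irr A = ∑ B ∈ P.parts with A ≠ B ∧ ¬ G.IsUniform ε A B, (#B : ℝ) := rfl
    rw [hirrdef] at hg
    have hηn : 0 < η * n := by positivity
    linarith

lemma IsBottlegraph.exists_bound {h m k : ℕ} {H : SimpleGraph (Fin h)} {p : Fin m → Fin k}
    (hbot : IsBottlegraph H p) :
    ∃ T : ℕ, ∀ φ : Equiv.Perm (Fin m), IsIntervalLabeling p φ →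
      ∃ t : ℕ, 0 < t ∧ t ≤ T ∧ ∀ (N : ℕ) (G : SimpleGraph (Fin N)),
        IsOrderedBlowup p φ t G → HasPerfectTiling H G := by
  choose! f hf using hbot
  exact ⟨Finset.univ.sup f, fun φ hφ =>
    ⟨f φ, (hf φ hφ).1, Finset.le_sup (Finset.mem_univ φ), (hf φ hφ).2⟩⟩

/-- Inside large subsets of a regular clique of clusters there is a perfectly tiled set which meets
the clusters in the proportions of the parts of the bottlegraph. -/
lemma exists_tiled_blowup {h m k n : ℕ} {H : SimpleGraph (Fin h)} {p : Fin m → Fin k}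
    (hk : 0 < k) {T : ℕ}
    (hbot : ∀ φ : Equiv.Perm (Fin m), IsIntervalLabeling p φ →
      ∃ t : ℕ, 0 < t ∧ t ≤ T ∧ ∀ (N : ℕ) (G : SimpleGraph (Fin N)),
        IsOrderedBlowup p φ t G → HasPerfectTiling H G)
    (G : SimpleGraph (Fin n)) [DecidableRel G.Adj] (A : Fin k → Finset (Fin n)) {ε ρ θ : ℝ}
    (hε : 0 < ε) (hρ : 0 < ρ) (hρ' : ρ ≤ 1 / 2) (hθ : 0 < θ)
    (hκ : k * ε ≤ ρ ^ (T * m) * (θ / (2 * k)))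
    (hA : ∀ i, 1 ≤ ρ ^ (T * m) * (θ / (2 * k)) * #(A i))
    (hreg : ∀ i j, i ≠ j → ∀ X ⊆ A i, ∀ Y ⊆ A j, ε * #(A i) ≤ #X → ε * #(A j) ≤ #Y →
      ∃ v ∈ X, ρ * #Y ≤ #{w ∈ Y | G.Adj v w})
    (L : Fin k → Finset (Fin n)) (hLA : ∀ i, L i ⊆ A i) (hL : ∀ i, θ * #(A i) ≤ #(L i)) :
    ∃ (t : ℕ) (X : Fin k → Finset (Fin n)), 0 < t ∧ t ≤ T ∧ (∀ i, X i ⊆ L i) ∧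
      (∀ i, #(X i) = t * #{x | p x = i}) ∧ HasPerfectTilingOn H G (Finset.univ.biUnion X) := by
  have hk' : (0 : ℝ) < k := by exact_mod_cast hk
  have hLk : ∀ i, 2 * k ≤ #(L i) := by
    intro i
    have h1 : ρ ^ (T * m) ≤ 1 := pow_le_one₀ hρ.le (by linarith)
    have h2 : 1 ≤ θ / (2 * k) * #(A i) := by
      refine (hA i).trans ?_
      rw [mul_assoc]
      exact mul_le_of_le_one_left (by positivity) h1
    rw [div_mul_eq_mul_div, le_div_iff₀ (by positivity), one_mul] at h2
    exact_mod_cast h2.trans (hL i)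
  obtain ⟨rk, L', hinj, hsub, hsep⟩ := exists_separated_subsets (fun i => #(L i) / k) Finset.univ
    (fun i _ => Nat.div_pos (by have := hLk i; omega) hk) L (fun i _ => by
      rw [Finset.card_univ, Fintype.card_fin]
      exact Nat.mul_div_le _ _)
  have hL' : ∀ i, θ / (2 * k) * #(A i) ≤ #(L' i) := by
    intro i
    have h1 : #(L i) < k * (#(L i) / k + 1) := Nat.lt_mul_div_succ _ hk
    have h2 : 1 ≤ #(L i) / k := Nat.div_pos (by have := hLk i; omega) hk
    have h3 : #(L i) / k ≤ #(L' i) := (hsub i (Finset.mem_univ i)).2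
    have h4 : #(L i) ≤ k * (2 * #(L' i)) := h1.le.trans (Nat.mul_le_mul_left _ (by omega))
    have h5 : (#(L i) : ℝ) ≤ k * (2 * #(L' i)) := by exact_mod_cast h4
    rw [div_mul_eq_mul_div, div_le_iff₀ (by positivity)]
    linarith [hL i]
  let σ : Equiv.Perm (Fin k) := (Tuple.sort rk).symm
  have hσ : ∀ i j, σ i < σ j → rk i < rk j := by
    intro i j hij
    have h1 := Tuple.monotone_sort rk hij.le
    simp only [Function.comp_apply, σ, Equiv.apply_symm_apply] at h1
    refine lt_of_le_of_ne h1 fun heq => hij.ne ?_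
    rw [hinj (by simp) (by simp) heq]
  let φ : Equiv.Perm (Fin m) := (Tuple.sort fun x => σ (p x)).symm
  have hφ : ∀ x y, σ (p x) < σ (p y) → φ x < φ y := by
    intro x y hxy
    by_contra! hle
    have h1 := Tuple.monotone_sort (fun x => σ (p x)) hle
    simp only [Function.comp_apply, φ, Equiv.apply_symm_apply] at h1
    exact absurd hxy (not_lt.2 h1)
  obtain ⟨t, ht0, htT, ht⟩ := hbot φ ⟨σ, hφ⟩
  obtain ⟨X, hXL, hXcard, hX⟩ := exists_complete_multipartite G A hε hρ hρ' hκ hA hreg (t * m)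
    (fun i => t * #{x | p x = i}) (by
      rw [← Finset.mul_sum, ← Finset.card_eq_sum_card_fiberwise (f := p) (by intro x _; simp)]
      simp) L' (fun i => (hsub i (Finset.mem_univ i)).1.trans (hLA i)) (by
      intro i
      have h1 : ρ ^ (T * m) ≤ ρ ^ (t * m) :=
        pow_le_pow_of_le_one hρ.le (by linarith) (Nat.mul_le_mul_right _ htT)
      rw [mul_assoc]
      exact mul_le_mul h1 (hL' i) (by positivity) (by positivity))
  refine ⟨t, X, ht0, htT, fun i => (hXL i).trans (hsub i (Finset.mem_univ i)).1, hXcard, ?_⟩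
  refine hasPerfectTilingOn_of_separated hφ ht X hXcard (fun i j hij x hx y hy => ?_) hX
  exact hsep i (Finset.mem_univ i) j (Finset.mem_univ j) (hσ i j hij) x (hXL i hx) y (hXL j hy)

/-- Greedy rounding of a fractional tiling with capacities slightly below the cluster sizes. -/
lemma exists_tiling_of_budget {h k n : ℕ} {H : SimpleGraph (Fin h)} {G : SimpleGraph (Fin n)}
    {ι : Type*} [Fintype ι] [DecidableEq ι] (𝒱 : Finset (Finset (Fin n)))
    (h𝒱 : (𝒱 : Set (Finset (Fin n))).PairwiseDisjoint id) (c : ι → Fin k → Finset (Fin n))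
    (hc : ∀ e i, c e i ∈ 𝒱) (hcinj : ∀ e, Function.Injective (c e)) (u : Fin k → ℕ) {θ : ℝ} {T : ℕ}
    (hstep : ∀ e (L : Fin k → Finset (Fin n)), (∀ i, L i ⊆ c e i) →
      (∀ i, θ * #(c e i) ≤ #(L i)) →
      ∃ (t : ℕ) (X : Fin k → Finset (Fin n)), 0 < t ∧ t ≤ T ∧ (∀ i, X i ⊆ L i) ∧
        (∀ i, #(X i) = t * u i) ∧ HasPerfectTilingOn H G (Finset.univ.biUnion X))
    (b : ι → ℕ)
    (hb : ∀ A ∈ 𝒱, ∑ e, ∑ i, (if c e i = A then (u i : ℝ) * b e else 0) ≤ (1 - θ) * #A) :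
    ∃ S : Finset (Fin n), HasPerfectTilingOn H G S ∧
      (∑ i, (u i : ℝ)) * ∑ e, ((b e : ℝ) - T) ≤ #S := by
  let good : Set (ι → ℕ) := {s | s ≤ b ∧ ∃ S : Finset (Fin n), HasPerfectTilingOn H G S ∧
    #S = (∑ i, u i) * ∑ e, s e ∧
    ∀ A ∈ 𝒱, #(S ∩ A) ≤ ∑ e, ∑ i, (if c e i = A then u i * s e else 0)}
  have hfin : good.Finite := (Set.finite_Iic b).subset fun s hs => hs.1
  have hne : good.Nonempty := by
    refine ⟨0, fun _ => Nat.zero_le _, ∅, ⟨∅, by simp, by simp, by simp⟩, by simp, by simp⟩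
  obtain ⟨s, ⟨hsb, S, hS, hScard, hSA⟩, hmax⟩ :=
    Set.exists_max_image good (fun s => ∑ e, s e) hfin hne
  have hlt : ∀ e, b e < s e + T := by
    by_contra! hcon
    obtain ⟨e, he⟩ := hcon
    have hleft : ∀ i, θ * #(c e i) ≤ #(c e i \ S) := by
      intro i
      have h1 := hb _ (hc e i)
      have h2 : (#(S ∩ c e i) : ℝ) ≤ (1 - θ) * #(c e i) := by
        refine le_trans ?_ h1
        refine le_trans (Nat.cast_le.2 (hSA _ (hc e i))) ?_
        push_cast
        refine Finset.sum_le_sum fun e' _ => Finset.sum_le_sum fun i' _ => ?_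
        have : (s e' : ℝ) ≤ b e' := by exact_mod_cast hsb e'
        split_ifs
        · gcongr
        · exact le_rfl
      have h3 : (#(c e i \ S) : ℝ) + #(S ∩ c e i) = #(c e i) := by
        rw [Finset.inter_comm]
        exact_mod_cast Finset.card_sdiff_add_card_inter _ _
      linarith
    obtain ⟨t, X, ht0, htT, hXL, hXcard, hX⟩ :=
      hstep e (fun i => c e i \ S) (fun i => Finset.sdiff_subset) hleft
    have hXc : ∀ i, X i ⊆ c e i := fun i => (hXL i).trans Finset.sdiff_subset
    have hdisj : Disjoint S (Finset.univ.biUnion X) := by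
      rw [Finset.disjoint_biUnion_right]
      exact fun i _ => Finset.disjoint_of_subset_right (hXL i) Finset.disjoint_sdiff
    have hsum : ∀ (f : ι → ℕ → ℕ), (∀ e x y, f e (x + y) = f e x + f e y) →
        ∑ e', f e' (Function.update s e (s e + t) e') = ∑ e', f e' (s e') + f e t := by
      intro f hf
      rw [← Finset.add_sum_erase _ _ (Finset.mem_univ e),
        ← Finset.add_sum_erase (a := e) _ (fun e' => f e' (s e')) (Finset.mem_univ e),
        Function.update_self, hf, Finset.sum_congr rfl fun e' he' => by
          rw [Function.update_of_ne (Finset.ne_of_mem_erase he')]]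
      ring
    have hnew : Function.update s e (s e + t) ∈ good := by
      refine ⟨?_, S ∪ Finset.univ.biUnion X, hS.union hX hdisj, ?_, ?_⟩
      · intro e'
        by_cases h : e' = e
        · subst h
          rw [Function.update_self]
          exact (Nat.add_le_add_left htT _).trans he
        · rw [Function.update_of_ne h]
          exact hsb e'
      · rw [Finset.card_union_of_disjoint hdisj, hScard, hsum (fun _ x => x) fun _ _ _ => rfl,
          Finset.card_biUnion]
        · simp only [hXcard, ← Finset.mul_sum]
          ring
        · intro i _ j _ hij
          exact Finset.disjoint_of_subset_left (hXc i) (Finset.disjoint_of_subset_right (hXc j)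
            (h𝒱 (hc e i) (hc e j) fun h => hij (hcinj e h)))
      · intro A hA
        rw [hsum (fun e' x => ∑ i, if c e' i = A then u i * x else 0) fun e' x y => by
          rw [← Finset.sum_add_distrib]
          refine Finset.sum_congr rfl fun i _ => ?_
          split_ifs <;> ring]
        rw [Finset.union_inter_distrib_right, Finset.biUnion_inter]
        refine (Finset.card_union_le _ _).trans (Nat.add_le_add (hSA A hA) ?_)
        refine Finset.card_biUnion_le.trans (Finset.sum_le_sum fun i _ => ?_)
        split_ifs with h
        · rw [mul_comm, ← hXcard]
          exact Finset.card_le_card Finset.inter_subset_left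
        · have : X i ∩ A = ∅ := Finset.disjoint_iff_inter_eq_empty.1
            (Finset.disjoint_of_subset_left (hXc i) (h𝒱 (hc e i) hA h))
          simp [this]
    have h1 : ∑ e', Function.update s e (s e + t) e' ≤ ∑ e', s e' := hmax _ hnew
    rw [hsum (fun _ x => x) fun _ _ _ => rfl] at h1
    omega
  refine ⟨S, hS, ?_⟩
  rw [hScard]
  push_cast
  refine mul_le_mul_of_nonneg_left (Finset.sum_le_sum fun e _ => ?_)
    (Finset.sum_nonneg fun i _ => Nat.cast_nonneg _)
  have : (b e : ℝ) ≤ s e + T := by exact_mod_cast (hlt e).le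
  linarith

/-- A reduced graph of large minimum degree whose cliques can be tiled greedily yields a tiling
covering almost all vertices of the clusters. -/
lemma exists_tiling_of_reduced {h m n r : ℕ} {H : SimpleGraph (Fin h)} {G : SimpleGraph (Fin n)}
    {p : Fin m → Fin (r + 2)} (hparts : ∀ i, ∃ x, p x = i) (i₀ : Fin (r + 2))
    (𝒱 : Finset (Finset (Fin n))) (h𝒱 : (𝒱 : Set (Finset (Fin n))).PairwiseDisjoint id)
    (hpos : 0 < ∑ A ∈ 𝒱, (#A : ℝ)) (R : Finset (Fin n) → Finset (Fin n) → Prop) [DecidableRel R]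
    (hsymm : ∀ A B, R A B → R B A) (hne : ∀ A B, R A B → A ≠ B)
    (hdeg : ∀ A ∈ 𝒱, (1 - ((m : ℝ) - #{x | p x = i₀}) / ((r + 1) * m)) * n ≤
      ∑ B ∈ 𝒱 with R A B, (#B : ℝ))
    {θ : ℝ} (hθ : θ ≤ 1) {T : ℕ}
    (hstep : ∀ c : Fin (r + 2) → Finset (Fin n), (∀ i, c i ∈ 𝒱) →
      (∀ i j, i ≠ j → R (c i) (c j)) →
      ∀ L : Fin (r + 2) → Finset (Fin n), (∀ i, L i ⊆ c i) → (∀ i, θ * #(c i) ≤ #(L i)) →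
      ∃ (t : ℕ) (X : Fin (r + 2) → Finset (Fin n)), 0 < t ∧ t ≤ T ∧ (∀ i, X i ⊆ L i) ∧
        (∀ i, #(X i) = t * #{x | p x = i}) ∧ HasPerfectTilingOn H G (Finset.univ.biUnion X)) :
    ∃ S : Finset (Fin n), HasPerfectTilingOn H G S ∧
      (1 - θ) * ∑ A ∈ 𝒱, (#A : ℝ) - m * ((T + 1) * #𝒱 ^ (r + 2)) ≤ #S := by
  classical
  have hu : ∀ i, 0 < #{x | p x = i} := fun i => by
    obtain ⟨x, hx⟩ := hparts i
    exact Finset.card_pos.2 ⟨x, by simpa using hx⟩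
  have hum : ∑ i, (#{x | p x = i} : ℝ) = m := by
    have := Finset.card_eq_sum_card_fiberwise (f := p) (s := Finset.univ) (t := Finset.univ)
      (by intro x _; simp)
    rw [Finset.card_univ, Fintype.card_fin] at this
    exact_mod_cast this.symm
  have hum₀ : (#{x | p x = i₀} : ℝ) ≤ m := by
    rw [← hum]
    exact Finset.single_le_sum (f := fun i => (#{x | p x = i} : ℝ))
      (fun i _ => Nat.cast_nonneg _) (Finset.mem_univ i₀)
  have hu₀ : (0 : ℝ) < #{x | p x = i₀} := by exact_mod_cast hu i₀
  have hm : (0 : ℝ) < m := hu₀.trans_le hum₀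
  set W := ∑ A ∈ 𝒱, (#A : ℝ) with hW
  have hWn : W ≤ n := by
    have h1 : #(𝒱.biUnion id) ≤ n := by simpa using Finset.card_le_univ (𝒱.biUnion id)
    rw [Finset.card_biUnion fun A hA B hB hAB => h𝒱 hA hB hAB] at h1
    rw [hW]
    simp only [id] at h1
    exact_mod_cast h1
  have hsum : ∀ f : Finset (Fin n) → ℝ, ∑ a : 𝒱, f a.1 = ∑ A ∈ 𝒱, f A := fun f =>
    Finset.sum_coe_sort 𝒱 f
  have hWsum : ∑ a : 𝒱, (#a.1 : ℝ) = W := hsum fun A => (#A : ℝ)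
  have hne𝒱 : Nonempty 𝒱 := by
    by_contra hemp
    rw [not_nonempty_iff] at hemp
    rw [← hWsum, Finset.univ_eq_empty, Finset.sum_empty] at hpos
    exact lt_irrefl _ hpos
  obtain ⟨w, hw0, hw, hwsum⟩ := exists_fractional_tiling (V := 𝒱) (fun a b => R a.1 b.1)
    (fun a b => hsymm _ _) (fun a => (#a.1 : ℝ)) (fun a => Nat.cast_nonneg _)
    (by rwa [hWsum]) (fun i => (#{x | p x = i} : ℝ)) i₀ hu₀ (fun i => Nat.cast_nonneg _) (by
      intro a
      rw [hum, hWsum]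
      have h1 : ∑ b : 𝒱 with ¬ R a.1 b.1, (#b.1 : ℝ) = W - ∑ B ∈ 𝒱 with R a.1 B, (#B : ℝ) := by
        rw [eq_sub_iff_add_eq, Finset.sum_filter, Finset.sum_filter,
          hsum fun B => if ¬ R a.1 B then (#B : ℝ) else 0, ← Finset.sum_add_distrib]
        refine Finset.sum_congr rfl fun B _ => ?_
        by_cases hB : R a.1 B <;> simp [hB]
      have h2 : (0 : ℝ) ≤ 1 - ((m : ℝ) - #{x | p x = i₀}) / ((r + 1) * m) := by
        rw [sub_nonneg, div_le_one (by positivity)]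
        nlinarith [mul_nonneg (Nat.cast_nonneg (α := ℝ) r) hm.le]
      have h3 := (mul_le_mul_of_nonneg_left hWn h2).trans (hdeg a.1 a.2)
      rw [h1]
      calc ((r : ℝ) + 1) * m * (W - ∑ B ∈ 𝒱 with R a.1 B, (#B : ℝ))
          ≤ (r + 1) * m * (((m : ℝ) - #{x | p x = i₀}) / ((r + 1) * m) * W) := by
            gcongr
            linarith
        _ = (m - #{x | p x = i₀}) * W := by field_simp)
  rw [hum, hWsum] at hwsum
  obtain ⟨S, hS, hScard⟩ := exists_tiling_of_budget
    (ι := OrdClique (fun a b : 𝒱 => R a.1 b.1) (r + 2))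
    (H := H) (G := G) 𝒱 h𝒱 (fun e i => (e.1 i).1) (fun e i => (e.1 i).2)
    (fun e i j hij => by
      by_contra hne'
      exact hne _ _ (e.2 i j hne') hij)
    (fun i => #{x | p x = i})
    (fun e L hL hL' => hstep _ (fun i => (e.1 i).2) (fun i j hij => e.2 i j hij) L hL hL')
    (fun e => ⌊(1 - θ) * w e⌋₊) (by
      intro A hA
      refine le_trans ?_ (mul_le_mul_of_nonneg_left (hw ⟨A, hA⟩) (sub_nonneg.2 hθ))
      rw [Finset.mul_sum]
      refine Finset.sum_le_sum fun e _ => ?_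
      rw [Finset.mul_sum]
      refine Finset.sum_le_sum fun i _ => ?_
      have h1 := Nat.floor_le (mul_nonneg (sub_nonneg.2 hθ) (hw0 e))
      by_cases h2 : (e.1 i).1 = A
      · rw [if_pos h2, if_pos (Subtype.ext h2), mul_left_comm]
        exact mul_le_mul_of_nonneg_left h1 (Nat.cast_nonneg _)
      · rw [if_neg h2, if_neg fun h => h2 (congrArg Subtype.val h), mul_zero])
  refine ⟨S, hS, le_trans ?_ hScard⟩
  rw [hum]
  have hcard : (Fintype.card (OrdClique (fun a b : 𝒱 => R a.1 b.1) (r + 2)) : ℝ) ≤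
      #𝒱 ^ (r + 2) := by
    have := Fintype.card_subtype_le
      fun c : Fin (r + 2) → 𝒱 => ∀ i j, i ≠ j → R (c i).1 (c j).1
    rw [Fintype.card_fun, Fintype.card_fin, Fintype.card_coe] at this
    exact_mod_cast this
  calc (1 - θ) * W - m * (((T : ℝ) + 1) * #𝒱 ^ (r + 2))
      ≤ (1 - θ) * W - m * (((T : ℝ) + 1) *
          Fintype.card (OrdClique (fun a b : 𝒱 => R a.1 b.1) (r + 2))) := by gcongr
    _ = m * ∑ e, ((1 - θ) * w e - 1 - T) := by
        rw [← hwsum]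
        simp only [Finset.sum_sub_distrib, Finset.sum_const, ← Finset.mul_sum, Finset.card_univ,
          nsmul_eq_mul]
        ring
    _ ≤ _ := by
        gcongr with e
        linarith [Nat.lt_floor_add_one ((1 - θ) * w e)]

theorem almost_perfect_tiling_framework (h m k : ℕ) (H : SimpleGraph (Fin h))
    (p : Fin m → Fin k) (hk : 2 ≤ k)
    (hparts : ∀ i : Fin k, ∃ x : Fin m, p x = i)
    (hbot : IsBottlegraph H p) (η : ℝ) (hη : 0 < η) :
    ∃ n₀ : ℕ, ∀ n : ℕ, n₀ ≤ n → ∀ G : SimpleGraph (Fin n),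
      (∀ v : Fin n,
        (1 - 1 / critChrom (SimpleGraph.comap p (⊤ : SimpleGraph (Fin k))) + η) * n ≤
          (odeg G v : ℝ)) →
      ∃ S : Finset (Fin n), HasPerfectTilingOn H G S ∧ (n : ℝ) - S.card ≤ η * n := by
  classical
  wlog hη1 : η ≤ 1 generalizing η
  · obtain ⟨n₀, hn₀⟩ := this 1 one_pos le_rfl
    refine ⟨n₀, fun n hn G hG => ?_⟩
    obtain ⟨S, hS, hle⟩ := hn₀ n hn G fun v => le_trans (by gcongr; linarith) (hG v)
    exact ⟨S, hS, hle.trans (by gcongr; linarith)⟩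
  obtain ⟨i₀, hi₀⟩ := exists_part_one_div_critChrom p hk hparts
  rw [hi₀]
  obtain ⟨r, rfl⟩ : ∃ r, k = r + 2 := ⟨k - 2, by omega⟩
  obtain ⟨T, hT⟩ := hbot.exists_bound
  obtain ⟨κ, hκ⟩ : ∃ κ : ℝ, κ = (η / 16) ^ (T * m) * (η / 4 / (2 * (r + 2 : ℕ))) := ⟨_, rfl⟩
  have hκ0 : 0 < κ := by rw [hκ]; positivity
  obtain ⟨ε, hε, hεκ, hεη⟩ : ∃ ε : ℝ, 0 < ε ∧ (r + 2 : ℕ) * ε ≤ κ ∧ 64 * ε ≤ η ^ 2 := by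
    refine ⟨min (κ / (r + 2 : ℕ)) (η ^ 2 / 64), by positivity, ?_, ?_⟩
    · rw [mul_comm, ← le_div_iff₀ (by positivity)]
      exact min_le_left _ _
    · rw [mul_comm, ← le_div_iff₀ (by positivity)]
      exact min_le_right _ _
  obtain ⟨K, n₁, hK, hreg⟩ := exists_regular_clusters hη hε hεη
  have hK' : (0 : ℝ) < K := by exact_mod_cast hK
  obtain ⟨n₂, hn₂⟩ := exists_nat_ge (2 * K / κ)
  obtain ⟨n₃, hn₃⟩ := exists_nat_ge (4 * (m * ((T + 1) * K ^ (r + 2))) / η)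
  refine ⟨n₁ + n₂ + n₃ + 1, fun n hn G hG => ?_⟩
  have hn0 : (0 : ℝ) < n := by exact_mod_cast (by omega : 0 < n)
  obtain ⟨𝒱, h𝒱, h𝒱K, h𝒱card, h𝒱sum, h𝒱deg⟩ := hreg n (by omega) G _ fun v => by
    have h1 : odeg G v = G.degree v := by
      rw [odeg, Set.ncard_eq_toFinset_card', ← SimpleGraph.card_neighborFinset_eq_degree]
      rfl
    rw [← h1]
    exact hG v
  have hpos : 0 < ∑ A ∈ 𝒱, (#A : ℝ) :=
    (mul_pos (by linarith) hn0).trans_le h𝒱sum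
  have hAκ : ∀ A ∈ 𝒱, 1 ≤ κ * #A := by
    intro A hA
    have h1 : (n : ℝ) ≤ 2 * K * #A := by exact_mod_cast h𝒱card A hA
    have h2 : 2 * K / κ ≤ n := hn₂.trans (by exact_mod_cast (by omega : n₂ ≤ n))
    have h3 := h2.trans h1
    rw [div_le_iff₀ hκ0, mul_assoc] at h3
    have h4 : (2 * K : ℝ) * 1 ≤ 2 * K * (κ * #A) := by linarith
    exact le_of_mul_le_mul_left h4 (by positivity)
  have hAcard : ∀ A ∈ 𝒱, (0 : ℝ) < #A := fun A hA =>
    pos_of_mul_pos_right (one_pos.trans_le (hAκ A hA)) hκ0.le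
  obtain ⟨S, hS, hScard⟩ := exists_tiling_of_reduced (H := H) (G := G) (θ := η / 4) (T := T) hparts
    i₀ 𝒱 h𝒱 hpos (ReducedAdj G ε (η / 8)) (fun A B hAB => hAB.symm) (fun A B hAB => hAB.1)
    (fun A hA => by
      refine le_trans (le_of_eq ?_) (h𝒱deg A hA)
      push_cast
      ring_nf) (by linarith)
    (fun c hc hcR => by
      refine exists_tiled_blowup (ρ := η / 16) (by omega) hT G c hε (by positivity) (by linarith)
        (by positivity) (hκ ▸ hεκ) (fun i => hκ ▸ hAκ _ (hc i)) ?_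
      intro i j hij X hX Y hY hXc hYc
      refine (hcR i j hij).exists_le_card_filter (by nlinarith) hX hY ?_ hXc hYc
      rw [← Finset.card_pos]
      exact_mod_cast (mul_pos hε (hAcard _ (hc i))).trans_le hXc)
  refine ⟨S, hS, ?_⟩
  have h1 : (m : ℝ) * ((T + 1) * #𝒱 ^ (r + 2)) ≤ η / 4 * n := by
    have h2 : 4 * (m * ((T + 1) * K ^ (r + 2))) / η ≤ n :=
      hn₃.trans (by exact_mod_cast (by omega : n₃ ≤ n))
    rw [div_le_iff₀ hη] at h2
    have h3 : (#𝒱 : ℝ) ≤ K := by exact_mod_cast h𝒱K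
    have h4 : (m : ℝ) * ((T + 1) * #𝒱 ^ (r + 2)) ≤ m * ((T + 1) * K ^ (r + 2)) := by gcongr
    linarith
  have h5 : (1 - η / 4) * ((1 - η / 4) * n) ≤ (1 - η / 4) * ∑ A ∈ 𝒱, (#A : ℝ) :=
    mul_le_mul_of_nonneg_left h𝒱sum (by linarith)
  have h6 : 0 ≤ η ^ 2 * n := by positivity
  have h7 : 0 ≤ η * n := by positivity
  linarith
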